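/- arXiv:math/0607737 — 4 statements merged into one kernel-verified Lean document; each statement's English description precedes it below -/
import Mathlib

section
/- Proposition (Cartier-Foata case). Let A = (a_{ij}) be an m×m matrix over R whose entries satisfy a_{ij}a_{kl} = a_{kl}a_{ij} for all 1 ≤ i,j,k,l ≤ m with i ≠ k (a Cartier-Foata matrix). Suppose the matrix I − A is invertible in the ring of m×m matrices over R and that det(I−A) is invertible in R. Then ((I−A)^{−1})_{11} = (det(I−A))^{−1} · det(I−A^{11}), where A^{11} denotes A with the first row and first column deleted and det(I−A^{11}) is the Cartier-Foata determinant of the corresponding (m−1)×(m−1) matrix. -/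
open scoped BigOperators

noncomputable section

/-- Number of inversions of a permutation of `Fin n`. -/
def invPerm {n : ℕ} (σ : Equiv.Perm (Fin n)) : ℕ :=
  (Finset.univ.filter fun p : Fin n × Fin n => p.1 < p.2 ∧ σ p.2 < σ p.1).card

/-- The Cartier-Foata determinant: `∑_σ (−1)^{inv σ} b_{σ(1)1} ⋯ b_{σ(n)n}`,
factors multiplied in the written order. -/
def cfDet {R : Type*} [Ring R] {n : ℕ} (B : Matrix (Fin n) (Fin n) R) : R :=
  ∑ σ : Equiv.Perm (Fin n),
    ((-1 : R) ^ invPerm σ) * ((List.finRange n).map fun i => B (σ i) i).prod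


lemma cf_sign {n : ℕ} (σ : Equiv.Perm (Fin n)) :
    ((Equiv.Perm.sign σ : ℤˣ) : ℤ) = (-1) ^ invPerm σ := by
  rw [Equiv.Perm.sign_eq_prod_prod_Iio, invPerm, ← Finset.prod_const, Finset.prod_filter,
    ← Finset.univ_product_univ, Finset.prod_product_right]
  push_cast
  refine Finset.prod_congr rfl fun j _ => ?_
  rw [← Finset.filter_gt_eq_Iio, Finset.prod_filter]
  refine Finset.prod_congr rfl fun i _ => ?_
  by_cases h : i < j
  · have hne : σ i ≠ σ j := fun e => h.ne (σ.injective e)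
    rcases lt_or_gt_of_ne hne with h1 | h1
    · simp [h, h1, h1.le, not_lt.mpr h1.le]
    · simp [h, h1, not_lt.mpr h1.le]
  · simp [h]

lemma cf_signR {R : Type*} [Ring R] {n : ℕ} (σ : Equiv.Perm (Fin n)) :
    (-1 : R) ^ invPerm σ = (((Equiv.Perm.sign σ : ℤˣ) : ℤ) : R) := by
  rw [cf_sign]; push_cast; rfl

lemma cf_alt {R : Type*} [Ring R] {n : ℕ} (B : Matrix (Fin n) (Fin n) R)
    (hB : ∀ i j k l : Fin n, i ≠ k → B i j * B k l = B k l * B i j)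
    (c : Fin n → Fin n) (a b : Fin n) (hab : a ≠ b) (hc : c a = c b) :
    ∑ σ : Equiv.Perm (Fin n), (((Equiv.Perm.sign σ : ℤˣ) : ℤ) : R) *
      ((List.finRange n).map fun i => B (σ i) (c i)).prod = 0 := by
  have hcs : ∀ k, c (Equiv.swap a b k) = c k := by
    intro k
    by_cases h1 : k = a
    · subst h1; simp [hc]
    by_cases h2 : k = b
    · subst h2; simp [hc]
    rw [Equiv.swap_apply_of_ne_of_ne h1 h2]
  refine Finset.sum_involution (fun σ _ => σ * Equiv.swap a b) ?_ ?_ ?_ ?_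
  · intro σ _
    have : ((List.finRange n).map fun i => B ((σ * Equiv.swap a b) i) (c i)).prod
        = ((List.finRange n).map fun i => B (σ i) (c i)).prod := by
      apply List.Perm.prod_eq'
      · have h1 : (List.finRange n).map (fun i => B ((σ * Equiv.swap a b) i) (c i))
            = ((List.finRange n).map (Equiv.swap a b)).map (fun i => B (σ i) (c i)) := by
          rw [List.map_map]
          refine List.map_congr_left fun i _ => ?_
          simp [hcs]
        rw [h1]
        exact (Equiv.Perm.map_finRange_perm (Equiv.swap a b)).map _
      · rw [List.pairwise_map]
        refine (List.nodup_finRange n).imp ?_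
        intro i j hij
        exact hB _ _ _ _ (fun e => hij ((σ * Equiv.swap a b).injective e))
    rw [this, Equiv.Perm.sign_mul, Equiv.Perm.sign_swap hab]
    simp
  · intro σ _ _ h
    have h2 : Equiv.swap a b = 1 := mul_eq_left.mp h
    exact hab (Equiv.swap_eq_one_iff.mp h2)
  · intro σ _; exact Finset.mem_univ _
  · intro σ _; simp [mul_assoc]

lemma cf_main {R : Type*} [Ring R] {n : ℕ} (B : Matrix (Fin (n+1)) (Fin (n+1)) R)
    (hB : ∀ i j k l : Fin (n+1), i ≠ k → B i j * B k l = B k l * B i j) 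
    (X : Matrix (Fin (n+1)) (Fin (n+1)) R) (hX : B * X = 1) :
    cfDet (fun i j : Fin n => B i.succ j.succ) = cfDet B * X 0 0 := by
  let s : Equiv.Perm (Fin (n+1)) → R := fun σ => (((Equiv.Perm.sign σ : ℤˣ) : ℤ) : R)
  let T : Equiv.Perm (Fin (n+1)) → R := fun σ =>
    ((List.finRange n).map fun k => B (σ k.succ) k.succ).prod
  let C : Fin (n+1) → R := fun i => ∑ σ, if σ 0 = i then s σ * T σ else 0
  have hT : ∀ σ j, T σ * B (σ 0) j = B (σ 0) j * T σ := by
    intro σ j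
    refine Commute.list_prod_left _ _ ?_
    intro x hx
    obtain ⟨k, _, rfl⟩ := List.mem_map.mp hx
    exact hB _ _ _ _ (fun e => Fin.succ_ne_zero k (σ.injective e))
  have hCB : ∀ j, ∑ i, C i * B i j = ∑ σ, s σ *
      ((List.finRange (n+1)).map fun i => B (σ i) ((Fin.cons j Fin.succ : Fin (n+1) → Fin (n+1)) i)).prod := by
    intro j
    simp only [C, Finset.sum_mul]
    rw [Finset.sum_comm]
    refine Finset.sum_congr rfl fun σ _ => ?_
    simp only [ite_mul, zero_mul, Finset.sum_ite_eq, Finset.mem_univ, if_true]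
    rw [mul_assoc, hT, List.finRange_succ, List.map_cons, List.prod_cons, List.map_map]
    rfl
  have h0 : ∑ i, C i * B i 0 = cfDet B := by
    rw [hCB, cfDet]
    refine Finset.sum_congr rfl fun σ _ => ?_
    rw [cf_signR]
    congr 3
    funext i
    refine Fin.cases ?_ (fun k => ?_) i <;> simp
  have hj : ∀ j, j ≠ 0 → ∑ i, C i * B i j = 0 := by
    intro j hj
    rw [hCB]
    refine cf_alt B hB _ 0 j hj.symm ?_
    obtain ⟨k, rfl⟩ := Fin.exists_succ_eq.mpr hj
    simp
  have hC0 : C 0 = cfDet (fun i j : Fin n => B i.succ j.succ) := by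
    simp only [C, cfDet]
    rw [← Equiv.sum_comp Equiv.Perm.decomposeFin.symm, Fintype.sum_prod_type,
      Finset.sum_eq_single 0]
    · refine Finset.sum_congr rfl fun e _ => ?_
      rw [cf_signR]
      simp [s, T]
    · intro p _ hp
      simp [hp]
    · simp
  have hv : Matrix.vecMul C B = Pi.single 0 (cfDet B) := by
    funext j
    by_cases h : j = 0
    · subst h; simpa [Matrix.vecMul, dotProduct] using h0
    · simpa [Matrix.vecMul, dotProduct, h] using hj j h
  have := congrArg (fun v => Matrix.vecMul v X 0) hv
  simp only [Matrix.vecMul_vecMul, hX, Matrix.vecMul_one, Matrix.single_vecMul] at this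
  rw [← hC0, this]
  simp

/-- **Proposition (Cartier-Foata case).**  If `A` is a Cartier-Foata matrix,
`I − A` is invertible as a matrix and `det(I−A)` is invertible in `R`, then
`((I−A)⁻¹)₁₁ = (det(I−A))⁻¹ · det(I − A¹¹)`. -/
theorem cartier_foata_inverse_entry (R : Type*) [Ring R] (m : ℕ) (hm : 1 ≤ m)
    (A : Matrix (Fin m) (Fin m) R)
    (hA : ∀ i j k l : Fin m, i ≠ k → A i j * A k l = A k l * A i j)
    (hMat : IsUnit ((1 : Matrix (Fin m) (Fin m) R) - A))
    (hDet : IsUnit (cfDet ((1 : Matrix (Fin m) (Fin m) R) - A)))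
    (h0 : (0 : ℕ) < m) :
    (Ring.inverse ((1 : Matrix (Fin m) (Fin m) R) - A)) ⟨0, h0⟩ ⟨0, h0⟩ =
      Ring.inverse (cfDet ((1 : Matrix (Fin m) (Fin m) R) - A)) *
        cfDet (fun i j : Fin (m - 1) =>
          ((1 : Matrix (Fin m) (Fin m) R) - A)
            ⟨i.1 + 1, by omega⟩ ⟨j.1 + 1, by omega⟩) := by
  obtain ⟨n, rfl⟩ : ∃ n, m = n + 1 := ⟨m - 1, by omega⟩
  have h := cf_main (1 - A) ?_ (Ring.inverse (1 - A)) (Ring.mul_inverse_cancel _ hMat)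
  · have h2 := congrArg (fun x => Ring.inverse (cfDet (1 - A)) * x) h
    simp only [← mul_assoc, Ring.inverse_mul_cancel _ hDet, one_mul] at h2
    exact h2.symm
  · intro i j k l hik
    have h1 : ∀ (i j : Fin (n+1)) (x : R), Commute ((1 : Matrix (Fin (n+1)) (Fin (n+1)) R) i j) x := by
      intro i j x
      rw [Matrix.one_apply]
      split_ifs
      · exact Commute.one_left x
      · exact Commute.zero_left x
    simp only [Matrix.sub_apply]
    exact ((h1 i j _).sub_left ((h1 k l _).symm.sub_right (hA i j k l hik)))
end
end

section
/- Proposition (right-quantum case). Let A = (a_{ij}) be an m×m matrix over R whose entries satisfy a_{jk}a_{ik} = a_{ik}a_{jk} and a_{ik}a_{jl} − a_{jk}a_{il} = a_{jl}a_{ik} − a_{il}a_{jk} for all 1 ≤ i,j,k,l ≤ m (a right-quantum matrix). Suppose the matrix I − A is invertible in the ring of m×m matrices over R and that det(I−A) is invertible in R. Then ((I−A)^{−1})_{11} = (det(I−A))^{−1} · det(I−A^{11}), where A^{11} denotes A with the first row and first column deleted and det(I−A^{11}) is the Cartier-Foata determinant of the corresponding (m−1)×(m−1) matrix. -/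
open scoped BigOperators

noncomputable section

open Equiv in
theorem rq_sign {n : ℕ} (σ : Perm (Fin n)) : Perm.sign σ = (-1 : ℤˣ) ^ invPerm σ := by
  rw [Perm.sign_eq_prod_prod_Ioi, invPerm, ← Finset.prod_const,
    Finset.prod_filter, Fintype.prod_prod_type]
  refine Finset.prod_congr rfl fun i _ => ?_
  rw [← Finset.filter_lt_eq_Ioi, Finset.prod_filter]
  refine Finset.prod_congr rfl fun j _ => ?_
  by_cases h : i < j
  · have : σ i ≠ σ j := fun e => h.ne (σ.injective e)
    by_cases h2 : σ i < σ j
    · simp [h, h2, h2.le]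
    · have h3 : σ j < σ i := lt_of_le_of_ne (not_lt.1 h2) this.symm
      simp [h, h2, h3]
  · simp [h]

/-- sign of a permutation in `R` -/
def rqs (R : Type*) [Ring R] {n : ℕ} (σ : Equiv.Perm (Fin n)) : R :=
  ((Equiv.Perm.sign σ : ℤ) : R)

/-- column determinant with prescribed columns -/
def rqF {R : Type*} [Ring R] {n : ℕ} (B : Matrix (Fin n) (Fin n) R) (c : Fin n → Fin n) : R :=
  ∑ σ : Equiv.Perm (Fin n), rqs R σ * ((List.finRange n).map fun i => B (σ i) (c i)).prod

theorem rq_cfDet {R : Type*} [Ring R] {n : ℕ} (B : Matrix (Fin n) (Fin n) R) :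
    cfDet B = rqF B id := by
  unfold cfDet rqF rqs
  refine Finset.sum_congr rfl fun σ _ => ?_
  rw [rq_sign]
  simp

theorem rqs_mul {R : Type*} [Ring R] {n : ℕ} (σ τ : Equiv.Perm (Fin n)) :
    rqs R (σ * τ) = rqs R σ * rqs R τ := by
  simp [rqs]

theorem rqs_swap {R : Type*} [Ring R] {n : ℕ} (i j : Fin n) (h : i ≠ j) :
    rqs R (Equiv.swap i j) = -1 := by
  simp [rqs, Equiv.Perm.sign_swap h]

theorem rqs_sq {R : Type*} [Ring R] {n : ℕ} (σ : Equiv.Perm (Fin n)) :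
    rqs R σ * rqs R σ = 1 := by
  rcases Int.units_eq_one_or (Equiv.Perm.sign σ) with h | h <;> simp [rqs, h]

theorem rqs_comm {R : Type*} [Ring R] {n : ℕ} (σ : Equiv.Perm (Fin n)) (x : R) :
    x * rqs R σ = rqs R σ * x := by
  rcases Int.units_eq_one_or (Equiv.Perm.sign σ) with h | h <;> simp [rqs, h]

theorem rq_split {n : ℕ} (i : Fin n) : ∃ l1 l2 : List (Fin (n+1)),
    List.finRange (n+1) = l1 ++ i.castSucc :: i.succ :: l2 ∧
    (∀ x ∈ l1, x ≠ i.castSucc ∧ x ≠ i.succ) ∧ (∀ x ∈ l2, x ≠ i.castSucc ∧ x ≠ i.succ) := by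
  have hs : List.finRange (n+1) = (List.finRange (n+1)).take i ++
      i.castSucc :: i.succ :: (List.finRange (n+1)).drop (i+2) := by
    conv_lhs => rw [← List.take_append_drop i (List.finRange (n+1))]
    rw [List.drop_eq_getElem_cons (by simp),
      List.drop_eq_getElem_cons (i := i+1) (by simp)]
    simp [Fin.ext_iff]
  refine ⟨_, _, hs, ?_, ?_⟩
  all_goals
    have hn := List.nodup_finRange (n+1)
    rw [hs] at hn
    intro x hx
    simp only [List.nodup_append, List.nodup_cons, List.mem_cons] at hn
    constructor <;> rintro rfl <;> grind

theorem rq_prod {R : Type*} [Ring R] {n : ℕ} (i : Fin n) (f : Fin (n+1) → R) :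
    ∃ P Q : R, ∀ g : Fin (n+1) → R,
      (∀ x, x ≠ i.castSucc → x ≠ i.succ → g x = f x) →
      ((List.finRange (n+1)).map g).prod = P * (g i.castSucc * g i.succ) * Q := by
  obtain ⟨l1, l2, h, h1, h2⟩ := rq_split i
  refine ⟨(l1.map f).prod, (l2.map f).prod, fun g hg => ?_⟩
  rw [h]
  have e1 : l1.map g = l1.map f :=
    List.map_congr_left fun x hx => hg x (h1 x hx).1 (h1 x hx).2
  have e2 : l2.map g = l2.map f :=
    List.map_congr_left fun x hx => hg x (h2 x hx).1 (h2 x hx).2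
  simp [e1, e2, mul_assoc]

section
variable {R : Type*} [Ring R] {n : ℕ} (B : Matrix (Fin (n+1)) (Fin (n+1)) R)

theorem rq_inv (i : Fin n) (T : Equiv.Perm (Fin (n+1)) → R)
    (h : ∀ σ, T σ + T (σ * Equiv.swap i.castSucc i.succ) = 0) : ∑ σ, T σ = 0 := by
  refine Finset.sum_involution (fun σ _ => σ * Equiv.swap i.castSucc i.succ)
    (fun σ _ => h σ) ?_ (by simp) (by simp [mul_assoc])
  intro σ _ _ e
  have := congrArg Equiv.Perm.sign e
  rw [Equiv.Perm.sign_mul, Equiv.Perm.sign_swap (Fin.castSucc_lt_succ (i := i)).ne] at this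
  rcases Int.units_eq_one_or (Equiv.Perm.sign σ) with h | h <;> simp [h] at this

theorem rq_adj (h2 : ∀ i j k l, B i k * B j l - B j k * B i l = B j l * B i k - B i l * B j k)
    (c : Fin (n+1) → Fin (n+1)) (i : Fin n) :
    rqF B (c ∘ Equiv.swap i.castSucc i.succ) = - rqF B c := by
  rw [eq_neg_iff_add_eq_zero]
  unfold rqF
  rw [← Finset.sum_add_distrib]
  apply rq_inv i
  intro σ
  obtain ⟨P, Q, hPQ⟩ := rq_prod i (fun x => B (σ x) (c x))
  have hx : ∀ x, x ≠ i.castSucc → x ≠ i.succ → Equiv.swap i.castSucc i.succ x = x :=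
    fun x => Equiv.swap_apply_of_ne_of_ne
  rw [hPQ _ (by intro x a b; simp [hx x a b]), hPQ _ (by intro x a b; simp),
    hPQ _ (by intro x a b; simp [hx x a b]), hPQ _ (by intro x a b; simp [hx x a b]),
    rqs_mul, rqs_swap _ _ (Fin.castSucc_lt_succ (i := i)).ne]
  simp only [Function.comp, Equiv.Perm.mul_apply, Equiv.swap_apply_left, Equiv.swap_apply_right]
  have := h2 (σ i.castSucc) (σ i.succ) (c i.castSucc) (c i.succ)
  have e : ∀ s a b d f : R, s * (P * a * Q) + s * (P * b * Q) +
    (s * -1 * (P * d * Q) + s * -1 * (P * f * Q)) = s * (P * ((b - f) - (d - a)) * Q) := by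
    intros; noncomm_ring
  rw [e, this]
  simp

theorem rq_adj_eq (h1 : ∀ i j k, B j k * B i k = B i k * B j k)
    (c : Fin (n+1) → Fin (n+1)) (i : Fin n) (hc : c i.castSucc = c i.succ) :
    rqF B c = 0 := by
  unfold rqF
  apply rq_inv i
  intro σ
  obtain ⟨P, Q, hPQ⟩ := rq_prod i (fun x => B (σ x) (c x))
  have hx : ∀ x, x ≠ i.castSucc → x ≠ i.succ → Equiv.swap i.castSucc i.succ x = x :=
    fun x => Equiv.swap_apply_of_ne_of_ne
  rw [hPQ _ (by intro x a b; simp),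
    hPQ _ (by intro x a b; simp [hx x a b]),
    rqs_mul, rqs_swap _ _ (Fin.castSucc_lt_succ (i := i)).ne]
  simp only [Equiv.Perm.mul_apply, Equiv.swap_apply_left, Equiv.swap_apply_right]
  rw [hc, h1 (σ i.castSucc) (σ i.succ)]
  simp

theorem rq_perm (h2 : ∀ i j k l, B i k * B j l - B j k * B i l = B j l * B i k - B i l * B j k)
    (τ : Equiv.Perm (Fin (n+1))) : ∀ c : Fin (n+1) → Fin (n+1),
    rqF B (c ∘ τ) = rqs R τ * rqF B c := by
  induction τ using Submonoid.dense_induction _ (Equiv.Perm.mclosure_swap_castSucc_succ n) with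
  | mem x hx =>
    obtain ⟨i, rfl⟩ := hx
    intro c
    simp only
    rw [rq_adj B h2, rqs_swap _ _ (Fin.castSucc_lt_succ (i := i)).ne, neg_one_mul]
  | one => intro c; simp [rqs]
  | mul x y hx hy =>
    intro c
    rw [Equiv.Perm.coe_mul, ← Function.comp_assoc, hy, hx, rqs_mul, ← mul_assoc,
      rqs_comm]

theorem rq_eq (h1 : ∀ i j k, B j k * B i k = B i k * B j k)
    (h2 : ∀ i j k l, B i k * B j l - B j k * B i l = B j l * B i k - B i l * B j k)
    (c : Fin (n+1) → Fin (n+1)) (i : Fin n) (q : Fin (n+1)) (hq : i.castSucc ≠ q)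
    (hc : c i.castSucc = c q) :
    rqF B c = 0 := by
  have := rq_perm B h2 (Equiv.swap i.succ q) c
  rw [rq_adj_eq B h1 _ i] at this
  · have h := congrArg (rqs R (Equiv.swap i.succ q) * ·) this
    simpa [← mul_assoc, rqs_sq] using h.symm
  · simp [Equiv.swap_apply_of_ne_of_ne (Fin.castSucc_lt_succ (i := i)).ne hq, hc]

/-- the first row of the left adjugate -/
def rqv (j : Fin (n+1)) : R := ∑ e : Equiv.Perm (Fin n),
  rqs R (Equiv.Perm.decomposeFin.symm (j, e)) * ((List.finRange n).map fun i =>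
    B (Equiv.Perm.decomposeFin.symm (j, e) i.succ) i.succ).prod

theorem rqv_zero : rqv B 0 = cfDet (fun i j : Fin n => B i.succ j.succ) := by
  refine Eq.trans ?_ (rq_cfDet _).symm
  unfold rqv rqF
  refine Finset.sum_congr rfl fun e _ => ?_
  simp [rqs]

theorem rqv_mul (k : Fin (n+1)) : ∑ j, rqv B j * B j k =
    rqs R (finRotate (n+1)) * rqF B (Fin.snoc (α := fun _ => Fin (n+1)) Fin.succ k) := by
  have : ∑ j, rqv B j * B j k = ∑ τ : Equiv.Perm (Fin (n+1)), rqs R τ *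
      ((List.finRange n).map fun i => B (τ i.succ) i.succ).prod * B (τ 0) k := by
    rw [← Equiv.sum_comp Equiv.Perm.decomposeFin.symm, Fintype.sum_prod_type]
    refine Finset.sum_congr rfl fun j _ => ?_
    rw [rqv, Finset.sum_mul]
    refine Finset.sum_congr rfl fun e _ => ?_
    rw [Equiv.Perm.decomposeFin_symm_apply_zero]
  rw [this, rqF, Finset.mul_sum]
  symm
  rw [← Equiv.sum_comp (Equiv.mulRight (finRotate (n+1)))]
  refine Finset.sum_congr rfl fun τ _ => ?_
  simp only [Equiv.coe_mulRight]
  rw [rqs_mul, rqs_comm, ← mul_assoc, ← mul_assoc, rqs_sq, one_mul,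
    List.finRange_succ_last]
  simp [mul_assoc, Function.comp_def]

theorem rqv_mul_eq (h1 : ∀ i j k, B j k * B i k = B i k * B j k)
    (h2 : ∀ i j k l, B i k * B j l - B j k * B i l = B j l * B i k - B i l * B j k)
    (k : Fin (n+1)) : ∑ j, rqv B j * B j k = if k = 0 then cfDet B else 0 := by
  rw [rqv_mul]
  split_ifs with h
  · subst h
    have : (Fin.snoc (α := fun _ => Fin (n+1)) Fin.succ 0 : Fin (n+1) → Fin (n+1))
        = id ∘ finRotate (n+1) := by
      funext x
      refine Fin.lastCases ?_ (fun i => ?_) x <;> simp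
    rw [this, rq_perm B h2, ← mul_assoc, rqs_sq, one_mul, rq_cfDet]
  · obtain ⟨i, rfl⟩ := Fin.exists_succ_eq.2 h
    rw [rq_eq B h1 h2 _ i (Fin.last n) (Fin.castSucc_lt_last i).ne (by simp), mul_zero]

theorem rq_main (h1 : ∀ i j k, B j k * B i k = B i k * B j k)
    (h2 : ∀ i j k l, B i k * B j l - B j k * B i l = B j l * B i k - B i l * B j k)
    (C : Matrix (Fin (n+1)) (Fin (n+1)) R) (hC : B * C = 1) :
    cfDet B * C 0 0 = cfDet (fun i j : Fin n => B i.succ j.succ) := by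
  rw [← rqv_zero]
  have h : Matrix.vecMul (rqv B) B = fun k => if k = 0 then cfDet B else 0 := by
    funext k
    exact rqv_mul_eq B h1 h2 k
  have h' := congrFun (congrArg (fun v => Matrix.vecMul v C) h) 0
  simp only [Matrix.vecMul_vecMul, hC, Matrix.vecMul_one] at h'
  rw [h']
  simp [Matrix.vecMul, dotProduct]

end

/-- **Proposition (right-quantum case).**  If `A` is a right-quantum matrix,
`I − A` is invertible as a matrix and `det(I−A)` is invertible in `R`, then
`((I−A)⁻¹)₁₁ = (det(I−A))⁻¹ · det(I − A¹¹)`. -/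
theorem right_quantum_inverse_entry (R : Type*) [Ring R] (m : ℕ) (hm : 1 ≤ m)
    (A : Matrix (Fin m) (Fin m) R)
    (hA1 : ∀ i j k : Fin m, A j k * A i k = A i k * A j k)
    (hA2 : ∀ i j k l : Fin m,
      A i k * A j l - A j k * A i l = A j l * A i k - A i l * A j k)
    (hMat : IsUnit ((1 : Matrix (Fin m) (Fin m) R) - A))
    (hDet : IsUnit (cfDet ((1 : Matrix (Fin m) (Fin m) R) - A)))
    (h0 : (0 : ℕ) < m) :
    (Ring.inverse ((1 : Matrix (Fin m) (Fin m) R) - A)) ⟨0, h0⟩ ⟨0, h0⟩ =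
      Ring.inverse (cfDet ((1 : Matrix (Fin m) (Fin m) R) - A)) *
        cfDet (fun i j : Fin (m - 1) =>
          ((1 : Matrix (Fin m) (Fin m) R) - A)
            ⟨i.1 + 1, by omega⟩ ⟨j.1 + 1, by omega⟩) := by
  obtain ⟨n, rfl⟩ : ∃ n, m = n + 1 := ⟨m - 1, by omega⟩
  have hcomm : ∀ (i j : Fin (n+1)) (x : R), Commute ((1 : Matrix (Fin (n+1)) (Fin (n+1)) R) i j) x := by
    intro i j x
    rw [Matrix.one_apply]
    split_ifs
    · exact Commute.one_left x
    · exact Commute.zero_left x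
  have hmain := rq_main (1 - A) ?_ ?_ (Ring.inverse (1 - A)) (Ring.mul_inverse_cancel _ hMat)
  · have := congrArg (Ring.inverse (cfDet (1 - A)) * ·) hmain
    simp only [← mul_assoc, Ring.inverse_mul_cancel _ hDet, one_mul] at this
    exact this
  · intro i j k
    simp only [Matrix.sub_apply]
    have a := (hcomm j k (1 : R))
    exact (((hcomm j k _).sub_right (hcomm j k _)).sub_left
      (((hcomm i k _).symm).sub_right (hA1 i j k))).eq
  · intro i j k l
    simp only [Matrix.sub_apply]
    have key : ∀ p q a b : R, (∀ x, p * x = x * p) → (∀ x, q * x = x * q) →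
        (p - a) * (q - b) - (q - b) * (p - a) = a * b - b * a := by
      intro p q a b hp hq
      have : (p - a) * (q - b) - (q - b) * (p - a) =
        (p * (q - b) - (q - b) * p) + (q * a - a * q) + (a * b - b * a) := by noncomm_ring
      rw [this, hp, hq]; simp
    have e1 := key _ _ (A i k) (A j l) (fun x => (hcomm i k x).eq) (fun x => (hcomm j l x).eq)
    have e2 := key _ _ (A j k) (A i l) (fun x => (hcomm j k x).eq) (fun x => (hcomm i l x).eq)
    have e3 : A i k * A j l - A j l * A i k = A j k * A i l - A i l * A j k := by
      have := hA2 i j k l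
      rw [sub_eq_sub_iff_add_eq_add] at this ⊢
      rw [this, add_comm]
    have e4 := e1.trans (e3.trans e2.symm)
    rw [sub_eq_sub_iff_add_eq_add] at e4 ⊢
    rw [e4, add_comm]
end
end

section
/- Lemma (the '1 = q' principle). Let φ : F → F be the ℂ-linear map determined on words by φ(a_{λ,μ}) = q^{inv μ − inv λ} a_{λ,μ}. Let I_rq ⊆ F be the two-sided ideal generated by the elements a_{jk}a_{ik} − a_{ik}a_{jk} for all i,j,k, and a_{ik}a_{jl} − a_{jk}a_{il} − a_{jl}a_{ik} + a_{il}a_{jk} for all i,j,k,l; and let I_{q-rq} ⊆ F be the two-sided ideal generated by a_{jk}a_{ik} − q a_{ik}a_{jk} for all i < j and all k, and a_{ik}a_{jl} − q^{−1} a_{jk}a_{il} − a_{jl}a_{ik} + q a_{il}a_{jk} for all i < j and k < l. Then: (a) φ maps I_rq into I_{q-rq}; and (b) if α and β are ℂ-linear combinations of circuits, then φ(αβ) = φ(α)·φ(β), where a word a_{λ,μ} is called a circuit if λ is a rearrangement of μ (λ and μ contain the same letters with the same multiplicities). -/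
open scoped BigOperators

noncomputable section

namespace OneEqQ

variable (m : ℕ)

/-- The free associative unital `ℂ`-algebra on `m²` generators `a_{ij}`. -/
abbrev F := FreeAlgebra ℂ (Fin m × Fin m)

/-- The generator `a_{ij}`. -/
def gen {m : ℕ} (i j : Fin m) : F m := FreeAlgebra.ι ℂ (i, j)

/-- The word `a_{λ,μ} = a_{λ₁μ₁} a_{λ₂μ₂} ⋯`. -/
def word {m : ℕ} (lam mu : List (Fin m)) : F m :=
  ((lam.zip mu).map fun p => gen p.1 p.2).prod

/-- The two-sided ideal of `F` generated by a set `S`, as a `ℂ`-submodule. -/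
def idealSpan {m : ℕ} (S : Set (F m)) : Submodule ℂ (F m) :=
  Submodule.span ℂ {z | ∃ x s y, s ∈ S ∧ z = x * s * y}

/-- The number of inversions of a word. -/
def invWord {m : ℕ} (μ : List (Fin m)) : ℕ :=
  (Finset.univ.filter fun p : Fin μ.length × Fin μ.length =>
    p.1 < p.2 ∧ μ.get p.2 < μ.get p.1).card

/-- The generators of the right-quantum ideal. -/
def rqRels : Set (F m) :=
  {x | ∃ i j k : Fin m, x = gen j k * gen i k - gen i k * gen j k} ∪
  {x | ∃ i j k l : Fin m,
    x = gen i k * gen j l - gen j k * gen i l - gen j l * gen i k +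
      gen i l * gen j k}

/-- The generators of the right-quantum `q`-ideal. -/
def rqqRels (q : ℂ) : Set (F m) :=
  {x | ∃ i j k : Fin m, i < j ∧
    x = gen j k * gen i k - q • (gen i k * gen j k)} ∪
  {x | ∃ i j k l : Fin m, i < j ∧ k < l ∧
    x = gen i k * gen j l - q⁻¹ • (gen j k * gen i l) - gen j l * gen i k +
      q • (gen i l * gen j k)}

/-- Circuits: words `a_{λ,μ}` in which `λ` is a rearrangement of `μ`. -/
def circuits : Set (F m) :=
  {x | ∃ lam mu : List (Fin m), lam.Perm mu ∧ x = word lam mu}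

/-- Recursive inversion count. -/
def invL {m : ℕ} : List (Fin m) → ℕ
  | [] => 0
  | a :: l => l.countP (fun b => decide (b < a)) + invL l

/-- Inversions between two words. -/
def crossInv {m : ℕ} (l₁ l₂ : List (Fin m)) : ℕ :=
  (l₁.map fun a => l₂.countP (fun b => decide (b < a))).sum

lemma countP_eq_sum {m : ℕ} (p : Fin m → Bool) (l : List (Fin m)) :
    l.countP p = ∑ i : Fin l.length, if p (l.get i) then 1 else 0 := by
  induction l with
  | nil => simp
  | cons a l ih =>
    rw [List.countP_cons, ih]
    simp only [List.length_cons]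
    rw [Fin.sum_univ_succ]
    simp [add_comm]
    rfl

lemma invWord_eq {m : ℕ} (l : List (Fin m)) : invWord l = invL l := by
  induction l with
  | nil => rfl
  | cons a l ih =>
    rw [invL, ← ih, countP_eq_sum]
    unfold invWord
    rw [Finset.card_filter, Finset.card_filter, Fintype.sum_prod_type, Fintype.sum_prod_type]
    simp only [List.length_cons]
    rw [Fin.sum_univ_succ]
    congr 1
    · rw [Fin.sum_univ_succ]
      simp
    · refine Finset.sum_congr rfl fun i _ => ?_
      rw [Fin.sum_univ_succ]
      simp

lemma invL_append {m : ℕ} (l₁ l₂ : List (Fin m)) :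
    invL (l₁ ++ l₂) = invL l₁ + invL l₂ + crossInv l₁ l₂ := by
  induction l₁ with
  | nil => simp [invL, crossInv]
  | cons a l ih =>
    simp only [List.cons_append, invL, ih, crossInv, List.countP_append, List.map_cons,
      List.sum_cons]
    ring

lemma crossInv_perm {m : ℕ} {l₁ l₂ k₁ k₂ : List (Fin m)} (h₁ : l₁.Perm k₁) (h₂ : l₂.Perm k₂) :
    crossInv l₁ l₂ = crossInv k₁ k₂ := by
  unfold crossInv
  rw [(h₁.map _).sum_eq]
  congr 1
  refine List.map_congr_left fun a _ => h₂.countP_eq _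

lemma inv_mid {m : ℕ} (l₁ l₂ : List (Fin m)) : ∃ (N : ℕ) (f : Fin m → ℕ), ∀ a b,
    invWord (l₁ ++ [a, b] ++ l₂) = N + (f a + f b) + if b < a then 1 else 0 := by
  refine ⟨invL l₁ + invL l₂ + crossInv l₁ l₂, fun a => crossInv l₁ [a] + crossInv [a] l₂, ?_⟩
  intro a b
  have h : ∀ l : List (Fin m), crossInv l [a, b] = crossInv l [a] + crossInv l [b] := by
    intro l
    induction l with
    | nil => simp [crossInv]
    | cons c l ih =>
      simp only [crossInv, List.map_cons, List.sum_cons, List.countP_cons, List.countP_nil] at ih ⊢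
      omega
  have h' : ∀ x y z : List (Fin m), crossInv (x ++ y) z = crossInv x z + crossInv y z := by
    intro x y z
    simp [crossInv]
  have h'' : crossInv [a, b] l₂ = crossInv [a] l₂ + crossInv [b] l₂ := h' [a] [b] l₂
  rw [invWord_eq, invL_append, invL_append, h', h, h'']
  simp only [invL, List.countP_cons, List.countP_nil, decide_eq_true_eq]
  omega

lemma word_append {m : ℕ} {l₁ m₁ : List (Fin m)} (l₂ m₂ : List (Fin m))
    (h : l₁.length = m₁.length) :
    word (l₁ ++ l₂) (m₁ ++ m₂) = word l₁ m₁ * word l₂ m₂ := by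
  simp [word, List.zip_append h]

/-- The words of `F`. -/
def wordSet (m : ℕ) : Set (F m) :=
  {x | ∃ l k : List (Fin m), l.length = k.length ∧ x = word l k}

lemma span_words (m : ℕ) (x : F m) : x ∈ Submodule.span ℂ (wordSet m) := by
  have hone : (1 : F m) ∈ Submodule.span ℂ (wordSet m) :=
    Submodule.subset_span ⟨[], [], rfl, by simp [word]⟩
  induction x using FreeAlgebra.induction with
  | grade0 r =>
    rw [Algebra.algebraMap_eq_smul_one]
    exact Submodule.smul_mem _ _ hone
  | grade1 p =>
    exact Submodule.subset_span ⟨[p.1], [p.2], rfl, by simp [word, gen]⟩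
  | add a b ha hb => exact Submodule.add_mem _ ha hb
  | mul a b ha hb =>
    have h := Submodule.mul_mem_mul ha hb
    rw [Submodule.span_mul_span] at h
    refine Submodule.span_mono ?_ h
    rintro _ ⟨_, ⟨l, k, hlk, rfl⟩, _, ⟨l', k', hlk', rfl⟩, rfl⟩
    exact ⟨l ++ l', k ++ k', by simp [hlk, hlk'], (word_append _ _ hlk).symm⟩

lemma phi_mid {m : ℕ} (q : ℂ) (hq : q ≠ 0) (φ : F m →ₗ[ℂ] F m)
    (hφ : ∀ lam mu : List (Fin m), lam.length = mu.length →
      φ (word lam mu) =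
        (q ^ invWord mu * (q ^ invWord lam)⁻¹) • word lam mu)
    {l₁ k₁ l₂ k₂ : List (Fin m)} (h₁ : l₁.length = k₁.length) (h₂ : l₂.length = k₂.length) :
    ∃ C : Fin m → Fin m → Fin m → Fin m → ℂ,
      (∀ a b c d, C a b c d = C b a c d) ∧ (∀ a b c d, C a b c d = C a b d c) ∧
      ∀ a b c d, φ (word l₁ k₁ * (gen a c * gen b d) * word l₂ k₂) =
        (C a b c d * ((if d < c then q else 1) * (if b < a then q⁻¹ else 1))) •
          (word l₁ k₁ * (gen a c * gen b d) * word l₂ k₂) := by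
  obtain ⟨N, f, hf⟩ := inv_mid l₁ l₂
  obtain ⟨M, g, hg⟩ := inv_mid k₁ k₂
  refine ⟨fun a b c d => q ^ (M + (g c + g d)) * (q ^ (N + (f a + f b)))⁻¹, ?_, ?_, ?_⟩
  · intro a b c d
    simp only [add_comm (f a)]
  · intro a b c d
    simp only [add_comm (g c)]
  · intro a b c d
    have hw : word l₁ k₁ * (gen a c * gen b d) * word l₂ k₂ =
        word (l₁ ++ [a, b] ++ l₂) (k₁ ++ [c, d] ++ k₂) := by
      rw [word_append _ _ (by simp [h₁]), word_append _ _ h₁]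
      simp [word]
    rw [hw, hφ _ _ (by simp [h₁, h₂]), hf, hg]
    congr 1
    split_ifs <;> simp [pow_succ] <;> ring

lemma idealSpan_mem {m : ℕ} {S : Set (F m)} {s : F m} (x y : F m) (hs : s ∈ S) :
    x * s * y ∈ idealSpan S := Submodule.subset_span ⟨x, s, y, hs, rfl⟩

lemma phi_words {m : ℕ} (q : ℂ) (hq : q ≠ 0) (φ : F m →ₗ[ℂ] F m)
    (hφ : ∀ lam mu : List (Fin m), lam.length = mu.length →
      φ (word lam mu) =
        (q ^ invWord mu * (q ^ invWord lam)⁻¹) • word lam mu)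
    {x y s : F m} (hx : x ∈ wordSet m) (hy : y ∈ wordSet m) (hs : s ∈ rqRels m) :
    φ (x * s * y) ∈ idealSpan (rqqRels m q) := by
  obtain ⟨l₁, k₁, h₁, rfl⟩ := hx
  obtain ⟨l₂, k₂, h₂, rfl⟩ := hy
  obtain ⟨C, hC₁, hC₂, hC⟩ := phi_mid q hq φ hφ h₁ h₂
  generalize word l₁ k₁ = x at *
  generalize word l₂ k₂ = y at *
  -- first relation, ordered
  have A : ∀ i j k : Fin m, i < j →
      φ (x * (gen j k * gen i k - gen i k * gen j k) * y) ∈ idealSpan (rqqRels m q) := by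
    intro i j k hij
    have := Submodule.smul_mem _ (C i j k k * q⁻¹)
      (idealSpan_mem x y (S := rqqRels m q) (Or.inl ⟨i, j, k, hij, rfl⟩))
    convert this using 1
    rw [mul_sub, sub_mul, map_sub, hC, hC, hC₁ j i]
    simp only [lt_irrefl, hij, hij.not_gt, if_true, if_false, mul_sub, sub_mul, smul_sub,
      mul_smul_comm, smul_mul_assoc, smul_smul]
    congr 2 <;> field_simp
  have A' : ∀ i j k : Fin m,
      φ (x * (gen j k * gen i k - gen i k * gen j k) * y) ∈ idealSpan (rqqRels m q) := by
    intro i j k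
    rcases lt_trichotomy i j with h | h | h
    · exact A i j k h
    · subst h; simp
    · have := Submodule.neg_mem _ (A j i k h)
      rwa [← map_neg, ← neg_mul, ← mul_neg, neg_sub] at this
  have B : ∀ i j k l : Fin m, i < j → k < l →
      φ (x * (gen i k * gen j l - gen j k * gen i l - gen j l * gen i k +
        gen i l * gen j k) * y) ∈ idealSpan (rqqRels m q) := by
    intro i j k l hij hkl
    have := Submodule.smul_mem _ (C i j k l)
      (idealSpan_mem x y (S := rqqRels m q) (Or.inr ⟨i, j, k, l, hij, hkl, rfl⟩))
    convert this using 1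
    simp only [mul_sub, sub_mul, mul_add, add_mul, map_sub, map_add, hC]
    rw [hC₁ j i k l, hC₁ j i l k, hC₂ i j l k]
    simp only [hkl, hkl.not_gt, hij, hij.not_gt, if_true, if_false, smul_sub, smul_add,
      mul_smul_comm, smul_mul_assoc, smul_smul, mul_one, one_mul, mul_inv_cancel₀ hq]
  have B' : ∀ i j k l : Fin m, i < j →
      φ (x * (gen i k * gen j l - gen j k * gen i l - gen j l * gen i k +
        gen i l * gen j k) * y) ∈ idealSpan (rqqRels m q) := by
    intro i j k l hij
    rcases lt_trichotomy k l with h | h | h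
    · exact B i j k l hij h
    · subst h
      have := Submodule.add_mem _ (A' j i k) (A' j i k)
      rw [← map_add, ← add_mul, ← mul_add] at this
      convert this using 4
      abel
    · have := B i j l k hij h
      convert this using 4
      abel
  rcases hs with ⟨i, j, k, rfl⟩ | ⟨i, j, k, l, rfl⟩
  · exact A' i j k
  · rcases lt_trichotomy i j with h | h | h
    · exact B' i j k l h
    · subst h; simp
    · have := Submodule.neg_mem _ (B' j i k l h)
      rw [← map_neg, ← neg_mul, ← mul_neg] at this
      convert this using 4
      abel

/-- **Lemma (the `1 = q` principle).**  The linear map `φ` multiplying each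
word `a_{λ,μ}` by `q^{inv μ − inv λ}` (a) maps the right-quantum ideal into
the right-quantum `q`-ideal and (b) is multiplicative on linear combinations
of circuits. -/
theorem one_eq_q_principle (hm : 1 ≤ m) (q : ℂ) (hq : q ≠ 0)
    (φ : F m →ₗ[ℂ] F m)
    (hφ : ∀ lam mu : List (Fin m), lam.length = mu.length →
      φ (word lam mu) =
        (q ^ invWord mu * (q ^ invWord lam)⁻¹) • word lam mu) :
    (∀ x ∈ idealSpan (rqRels m), φ x ∈ idealSpan (rqqRels m q)) ∧
    (∀ α β : F m, α ∈ Submodule.span ℂ (circuits m) →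
      β ∈ Submodule.span ℂ (circuits m) → φ (α * β) = φ α * φ β) := by
  refine ⟨fun x hx => ?_, fun α β hα hβ => ?_⟩
  · unfold idealSpan at hx
    induction hx using Submodule.span_induction with
    | zero => simp
    | add a b _ _ ha hb => rw [map_add]; exact Submodule.add_mem _ ha hb
    | smul c a _ ha => rw [map_smul]; exact Submodule.smul_mem _ _ ha
    | mem z hz =>
      obtain ⟨x, s, y, hs, rfl⟩ := hz
      have hx := span_words m x
      have hy := span_words m y
      induction hx using Submodule.span_induction with
      | zero => simp
      | add a b _ _ ha hb => rw [add_mul, add_mul, map_add]; exact Submodule.add_mem _ ha hb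
      | smul c a _ ha =>
        rw [smul_mul_assoc, smul_mul_assoc, map_smul]; exact Submodule.smul_mem _ _ ha
      | mem x hx =>
        induction hy using Submodule.span_induction with
        | zero => simp
        | add a b _ _ ha hb => rw [mul_add, map_add]; exact Submodule.add_mem _ ha hb
        | smul c a _ ha => rw [mul_smul_comm, map_smul]; exact Submodule.smul_mem _ _ ha
        | mem y hy => exact phi_words q hq φ hφ hx hy hs
  · induction hα using Submodule.span_induction with
    | zero => simp
    | add a b _ _ ha hb => rw [add_mul, map_add, map_add, add_mul, ha, hb]
    | smul c a _ ha => rw [smul_mul_assoc, map_smul, map_smul, smul_mul_assoc, ha]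
    | mem x hx =>
      induction hβ using Submodule.span_induction with
      | zero => simp
      | add a b _ _ ha hb => rw [mul_add, map_add, map_add, mul_add, ha, hb]
      | smul c a _ ha => rw [mul_smul_comm, map_smul, map_smul, mul_smul_comm, ha]
      | mem y hy =>
        obtain ⟨l₁, k₁, h₁, rfl⟩ := hx
        obtain ⟨l₂, k₂, h₂, rfl⟩ := hy
        rw [← word_append _ _ h₁.length_eq, hφ _ _ (by simp [h₁.length_eq, h₂.length_eq]),
          hφ _ _ h₁.length_eq, hφ _ _ h₂.length_eq, word_append _ _ h₁.length_eq,
          smul_mul_smul_comm]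
        congr 1
        simp only [invWord_eq, invL_append, crossInv_perm h₁ h₂, pow_add]
        field_simp

end OneEqQ
end
end

section
/- Lemma (determinant properties of right-quantum matrices). Let B = (b_{ij}) be an m×m matrix over R. (1) If B is right-quantum and B′ is the matrix obtained from B by interchanging two adjacent columns, then det B′ = −det B. (2) If B is right-quantum and two columns of B are equal, then det B = 0. (3) For an arbitrary m×m matrix B over R (Laplace expansion along the last column): det B = Σ_{i=1}^m (−1)^{m+i} det(B^{im}) · b_{im}, where B^{im} denotes the (m−1)×(m−1) matrix obtained from B by deleting the i-th row and the m-th column. -/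
open scoped BigOperators

noncomputable section

/-- A matrix is right-quantum if `b_{jk}b_{ik} = b_{ik}b_{jk}` and
`b_{ik}b_{jl} − b_{jk}b_{il} = b_{jl}b_{ik} − b_{il}b_{jk}` for all `i,j,k,l`. -/
def IsRightQuantum {R : Type*} [Ring R] {n : ℕ}
    (B : Matrix (Fin n) (Fin n) R) : Prop :=
  (∀ i j k : Fin n, B j k * B i k = B i k * B j k) ∧
  (∀ i j k l : Fin n,
    B i k * B j l - B j k * B i l = B j l * B i k - B i l * B j k)

theorem neg_one_pow_invPerm_int {n : ℕ} (σ : Equiv.Perm (Fin n)) :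
    ((-1 : ℤˣ) ^ invPerm σ) = Equiv.Perm.sign σ := by
  rw [Equiv.Perm.sign_eq_prod_prod_Iio, invPerm, ← Finset.prod_const, Finset.prod_filter,
    ← Finset.univ_product_univ, Finset.prod_product_right]
  refine Finset.prod_congr rfl fun j _ => ?_
  rw [← Finset.prod_subset (Finset.subset_univ (Finset.Iio j))]
  · refine Finset.prod_congr rfl fun i hi => ?_
    have hij : i < j := Finset.mem_Iio.1 hi
    have hne : σ i ≠ σ j := fun h => hij.ne (σ.injective h)
    rcases lt_or_gt_of_ne hne with h | h
    · simp [h, h.le]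
    · simp [h, hij, h.le]
  · intro i _ hi
    have hij : ¬ i < j := fun h => hi (Finset.mem_Iio.2 h)
    simp [hij]

theorem neg_one_pow_invPerm {R : Type*} [Ring R] {n : ℕ} (σ : Equiv.Perm (Fin n)) :
    ((-1 : R) ^ invPerm σ) = (((Equiv.Perm.sign σ : ℤˣ) : ℤ) : R) := by
  rw [← neg_one_pow_invPerm_int]
  simp

/-- The permutation sending the last index to `i` and otherwise acting as `τ`. -/
def extPerm {n : ℕ} (i : Fin (n + 1)) (τ : Equiv.Perm (Fin n)) : Equiv.Perm (Fin (n + 1)) :=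
  (finSuccEquiv' (Fin.last n)).trans ((Equiv.optionCongr τ).trans (finSuccEquiv' i).symm)

theorem extPerm_last {n : ℕ} (i : Fin (n + 1)) (τ : Equiv.Perm (Fin n)) :
    extPerm i τ (Fin.last n) = i := by
  simp [extPerm]

theorem extPerm_castSucc {n : ℕ} (i : Fin (n + 1)) (τ : Equiv.Perm (Fin n)) (t : Fin n) :
    extPerm i τ t.castSucc = i.succAbove (τ t) := by
  have : finSuccEquiv' (Fin.last n) t.castSucc = some t := by
    rw [← Fin.succAbove_last_apply, finSuccEquiv'_succAbove]
  simp [extPerm, this]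

theorem extPerm_bijective (n : ℕ) :
    Function.Bijective (fun p : Fin (n + 1) × Equiv.Perm (Fin n) => extPerm p.1 p.2) := by
  rw [Fintype.bijective_iff_injective_and_card]
  constructor
  · rintro ⟨i, τ⟩ ⟨j, ρ⟩ h
    have h' : extPerm i τ = extPerm j ρ := h
    have hij : i = j := by
      rw [← extPerm_last i τ, h', extPerm_last]
    subst hij
    have : τ = ρ := by
      ext t : 1
      have := congrArg (fun σ => σ t.castSucc) h'
      simp only [extPerm_castSucc] at this
      exact Fin.succAbove_right_injective this
    rw [this]
  · simp [Fintype.card_perm, Nat.factorial_succ]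

theorem prod_lt_sign (n k : ℕ) (hk : k ≤ n) :
    (∏ s ∈ Finset.range n, if s < k then (1 : ℤˣ) else -1) = (-1) ^ (n + k) := by
  induction n with
  | zero => simp [Nat.le_zero.1 hk]
  | succ n ih =>
    rcases Nat.lt_or_ge n k with h | h
    · have : k = n + 1 := by omega
      subst this
      rw [Even.neg_one_pow ⟨n + 1, rfl⟩]
      refine Finset.prod_eq_one fun s hs => ?_
      rw [if_pos (Finset.mem_range.1 hs)]
    · rw [Finset.prod_range_succ, ih h, if_neg (by omega)]
      rw [show n + 1 + k = n + k + 1 by omega, pow_succ]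

theorem sign_extPerm {n : ℕ} (i : Fin (n + 1)) (τ : Equiv.Perm (Fin n)) :
    Equiv.Perm.sign (extPerm i τ) = (-1) ^ (n + 1 + (i.1 + 1)) * Equiv.Perm.sign τ := by
  have key : (∏ t : Fin n, if i.succAbove (τ t) < i then (1 : ℤˣ) else -1)
      = (-1) ^ (n + i.1) := by
    rw [Equiv.prod_comp τ (fun s => if i.succAbove s < i then (1 : ℤˣ) else -1),
      ← prod_lt_sign n i.1 (by omega), ← Fin.prod_univ_eq_prod_range
        (fun s => if s < i.1 then (1 : ℤˣ) else -1)]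
    refine Finset.prod_congr rfl fun s _ => ?_
    simp only [Fin.succAbove_lt_iff_castSucc_lt]
    rfl
  have hlast : Finset.Iio (Fin.last n) = Finset.univ.map Fin.castSuccEmb := by
    ext x
    refine Fin.lastCases ?_ (fun t => ?_) x <;> simp [Fin.castSucc_ne_last]
  have hcast : ∀ t : Fin n, Finset.Iio t.castSucc = (Finset.Iio t).map Fin.castSuccEmb := by
    intro t
    ext x
    refine Fin.lastCases ?_ (fun t => ?_) x
    · simp [Fin.le_last]
    · simp
  rw [Equiv.Perm.sign_eq_prod_prod_Iio, Fin.prod_univ_castSucc, hlast, Finset.prod_map]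
  simp only [hcast, Finset.prod_map, Fin.coe_castSuccEmb, extPerm_castSucc, extPerm_last, key]
  rw [Equiv.Perm.sign_eq_prod_prod_Iio τ, mul_comm]
  congr 1
  · rw [show n + 1 + (i.1 + 1) = n + i.1 + 2 by omega, pow_add _ (n + i.1) 2]
    simp
  · refine Finset.prod_congr rfl fun j _ => Finset.prod_congr rfl fun k _ => ?_
    simp only [Fin.succAbove_lt_succAbove_iff]

theorem laplace_aux {R : Type*} [Ring R] (n : ℕ) (B : Matrix (Fin (n + 1)) (Fin (n + 1)) R) :
    cfDet B = ∑ i : Fin (n + 1), ((-1 : R) ^ (n + 1 + (i.1 + 1))) *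
      cfDet (fun s t : Fin n => B (i.succAbove s) t.castSucc) * B i (Fin.last n) := by
  unfold cfDet
  rw [← (extPerm_bijective n).sum_comp, Fintype.sum_prod_type]
  refine Finset.sum_congr rfl fun i _ => ?_
  rw [Finset.mul_sum, Finset.sum_mul]
  refine Finset.sum_congr rfl fun τ _ => ?_
  simp only [neg_one_pow_invPerm, sign_extPerm, List.finRange_succ_last, List.map_append,
    List.map_map, List.prod_append, List.map_cons, List.map_nil, List.prod_singleton,
    extPerm_last]
  have : ((fun j => B (extPerm i τ j) j) ∘ Fin.castSucc)
      = fun t => B (i.succAbove (τ t)) t.castSucc := by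
    funext t
    simp [extPerm_castSucc]
  rw [this]
  push_cast
  simp only [mul_assoc]

theorem finRange_split (m t : ℕ) (ht : t + 1 < m) :
    ∃ L₁ L₂ : List (Fin m),
      List.finRange m = L₁ ++ ((⟨t, Nat.lt_of_succ_lt ht⟩ : Fin m) :: ⟨t + 1, ht⟩ :: L₂) := by
  refine ⟨(List.finRange m).take t, (List.finRange m).drop (t + 2), ?_⟩
  have h1 : t < (List.finRange m).length := by simp; omega
  have h2 : t + 1 < (List.finRange m).length := by simp; omega
  conv_lhs => rw [← List.take_append_drop t (List.finRange m),
    List.drop_eq_getElem_cons h1, List.drop_eq_getElem_cons h2]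
  simp

/-- Splitting the ordered product at positions `t, t+1`; the outer factors do not change
under right multiplication by the adjacent transposition. -/
theorem prod_split {R : Type*} [Ring R] {m : ℕ} (t : ℕ) (ht : t + 1 < m)
    (σ : Equiv.Perm (Fin m)) (C : Matrix (Fin m) (Fin m) R) :
    ∃ P Q : R, ∀ C' : Matrix (Fin m) (Fin m) R,
      (∀ i j, j ≠ ⟨t, Nat.lt_of_succ_lt ht⟩ → j ≠ ⟨t + 1, ht⟩ → C' i j = C i j) →
      (((List.finRange m).map fun i => C' (σ i) i).prod
        = P * (C' (σ ⟨t, Nat.lt_of_succ_lt ht⟩) ⟨t, Nat.lt_of_succ_lt ht⟩ * C' (σ ⟨t + 1, ht⟩) ⟨t + 1, ht⟩) * Q) ∧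
      (((List.finRange m).map fun i =>
          C' ((σ * Equiv.swap (⟨t, Nat.lt_of_succ_lt ht⟩ : Fin m) ⟨t + 1, ht⟩) i) i).prod
        = P * (C' (σ ⟨t + 1, ht⟩) ⟨t, Nat.lt_of_succ_lt ht⟩ * C' (σ ⟨t, Nat.lt_of_succ_lt ht⟩) ⟨t + 1, ht⟩) * Q) := by
  obtain ⟨L₁, L₂, hL⟩ := finRange_split m t ht
  have hnd := List.nodup_finRange m
  rw [hL] at hnd
  have hne1 : ∀ x ∈ L₁, x ≠ ⟨t, Nat.lt_of_succ_lt ht⟩ ∧ x ≠ ⟨t + 1, ht⟩ := by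
    intro x hx
    have := (List.nodup_append.1 hnd).2.2 x hx
    exact ⟨this _ (by simp), this _ (by simp)⟩
  have hne2 : ∀ x ∈ L₂, x ≠ ⟨t, Nat.lt_of_succ_lt ht⟩ ∧ x ≠ ⟨t + 1, ht⟩ := by
    intro x hx
    have h := (List.nodup_append.1 hnd).2.1
    simp only [List.nodup_cons, List.mem_cons, not_or] at h
    exact ⟨fun e => h.1.2 (e ▸ hx), fun e => h.2.1 (e ▸ hx)⟩
  refine ⟨(L₁.map fun i => C (σ i) i).prod, (L₂.map fun i => C (σ i) i).prod, ?_⟩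
  intro C' hC
  have e : ∀ L : List (Fin m), (∀ x ∈ L, x ≠ ⟨t, Nat.lt_of_succ_lt ht⟩ ∧ x ≠ ⟨t + 1, ht⟩) →
      (L.map fun i => C' (σ i) i) = (L.map fun i => C (σ i) i) ∧
      (L.map fun i => C' ((σ * Equiv.swap (⟨t, Nat.lt_of_succ_lt ht⟩ : Fin m) ⟨t + 1, ht⟩) i) i)
        = (L.map fun i => C (σ i) i) := by
    intro L h
    constructor
    · exact List.map_congr_left fun x hx => hC _ _ (h x hx).1 (h x hx).2
    · refine List.map_congr_left fun x hx => ?_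
      rw [Equiv.Perm.mul_apply, Equiv.swap_apply_of_ne_of_ne (h x hx).1 (h x hx).2]
      exact hC _ _ (h x hx).1 (h x hx).2
  constructor
  · rw [hL, List.map_append, List.prod_append, (e L₁ hne1).1, List.map_cons, List.map_cons,
      (e L₂ hne2).1]
    simp [mul_assoc]
  · rw [hL, List.map_append, List.prod_append, (e L₁ hne1).2, List.map_cons, List.map_cons,
      (e L₂ hne2).2]
    simp [mul_assoc]

theorem sign_mul_adj {m : ℕ} (t : ℕ) (ht : t + 1 < m) (σ : Equiv.Perm (Fin m)) :
    Equiv.Perm.sign (σ * Equiv.swap (⟨t, Nat.lt_of_succ_lt ht⟩ : Fin m) ⟨t + 1, ht⟩)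
      = - Equiv.Perm.sign σ := by
  rw [Equiv.Perm.sign_mul, Equiv.Perm.sign_swap (by simp)]
  simp

theorem mul_adj_ne {m : ℕ} (t : ℕ) (ht : t + 1 < m) (σ : Equiv.Perm (Fin m)) :
    σ * Equiv.swap (⟨t, Nat.lt_of_succ_lt ht⟩ : Fin m) ⟨t + 1, ht⟩ ≠ σ := by
  intro h
  have h1 := sign_mul_adj t ht σ
  rw [h] at h1
  rcases Int.units_eq_one_or (Equiv.Perm.sign σ) with h2 | h2 <;> rw [h2] at h1 <;>
    exact absurd h1 (by decide)

theorem part_one {R : Type*} [Ring R] {m : ℕ} (B : Matrix (Fin m) (Fin m) R)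
    (hB : IsRightQuantum B) (t : ℕ) (ht : t + 1 < m) :
    cfDet (fun i j : Fin m => B i (Equiv.swap (⟨t, Nat.lt_of_succ_lt ht⟩ : Fin m) ⟨t + 1, ht⟩ j))
      = - cfDet B := by
  rw [eq_neg_iff_add_eq_zero]
  unfold cfDet
  rw [← Finset.sum_add_distrib]
  refine Finset.sum_involution
    (fun σ _ => σ * Equiv.swap (⟨t, Nat.lt_of_succ_lt ht⟩ : Fin m) ⟨t + 1, ht⟩) ?_
    (fun σ _ _ => mul_adj_ne t ht σ) (fun _ _ => Finset.mem_univ _) ?_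
  · intro σ _
    obtain ⟨P, Q, hPQ⟩ := prod_split t ht σ B
    obtain ⟨h1, h2⟩ := hPQ B (fun _ _ _ _ => rfl)
    obtain ⟨h3, h4⟩ := hPQ
      (fun i j : Fin m => B i (Equiv.swap (⟨t, Nat.lt_of_succ_lt ht⟩ : Fin m) ⟨t + 1, ht⟩ j))
      (fun i j hj hj' => by simp only [Equiv.swap_apply_of_ne_of_ne hj hj'])
    rw [h1, h2, h3, h4]
    simp only [neg_one_pow_invPerm, sign_mul_adj, Equiv.swap_apply_left, Equiv.swap_apply_right]
    have q := hB.2 (σ ⟨t, Nat.lt_of_succ_lt ht⟩) (σ ⟨t + 1, ht⟩) ⟨t, Nat.lt_of_succ_lt ht⟩ ⟨t + 1, ht⟩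
    generalize B (σ ⟨t, Nat.lt_of_succ_lt ht⟩) ⟨t, Nat.lt_of_succ_lt ht⟩ = a at *
    generalize B (σ ⟨t + 1, ht⟩) ⟨t + 1, ht⟩ = d at *
    generalize B (σ ⟨t, Nat.lt_of_succ_lt ht⟩) ⟨t + 1, ht⟩ = b at *
    generalize B (σ ⟨t + 1, ht⟩) ⟨t, Nat.lt_of_succ_lt ht⟩ = c at *
    push_cast
    generalize (((Equiv.Perm.sign σ : ℤˣ) : ℤ) : R) = s
    have : s * (P * (b * c) * Q) + s * (P * (a * d) * Q)
        + (-s * (P * (d * a) * Q) + -s * (P * (c * b) * Q))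
        = s * (P * ((a * d - c * b) - (d * a - b * c)) * Q) := by noncomm_ring
    rw [this, q]
    simp
  · intro σ _
    simp [mul_assoc]

theorem part_two_adj {R : Type*} [Ring R] {m : ℕ} (B : Matrix (Fin m) (Fin m) R)
    (hB : IsRightQuantum B) (t : ℕ) (ht : t + 1 < m)
    (h : ∀ i, B i ⟨t, Nat.lt_of_succ_lt ht⟩ = B i ⟨t + 1, ht⟩) : cfDet B = 0 := by
  unfold cfDet
  refine Finset.sum_involution
    (fun σ _ => σ * Equiv.swap (⟨t, Nat.lt_of_succ_lt ht⟩ : Fin m) ⟨t + 1, ht⟩) ?_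
    (fun σ _ _ => mul_adj_ne t ht σ) (fun _ _ => Finset.mem_univ _) ?_
  · intro σ _
    obtain ⟨P, Q, hPQ⟩ := prod_split t ht σ B
    obtain ⟨h1, h2⟩ := hPQ B (fun _ _ _ _ => rfl)
    rw [h1, h2]
    simp only [neg_one_pow_invPerm, sign_mul_adj, h]
    rw [hB.1 (σ ⟨t, Nat.lt_of_succ_lt ht⟩) (σ ⟨t + 1, ht⟩) ⟨t + 1, ht⟩]
    push_cast
    noncomm_ring
  · intro σ _
    simp [mul_assoc]

theorem part_two_lt {R : Type*} [Ring R] {m : ℕ} (d : ℕ) :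
    ∀ (B : Matrix (Fin m) (Fin m) R), IsRightQuantum B → ∀ (t : ℕ) (ht : t + d + 1 < m),
      (∀ i, B i ⟨t, by omega⟩ = B i ⟨t + d + 1, ht⟩) → cfDet B = 0 := by
  induction d with
  | zero => exact fun B hB t ht h => part_two_adj B hB t ht h
  | succ d ih =>
    intro B hB t ht h
    have h1 := part_one B hB (t + d + 1) (by omega)
    rw [ih (fun i j => B i (Equiv.swap (⟨t + d + 1, by omega⟩ : Fin m)
      ⟨t + d + 1 + 1, by omega⟩ j))
      ⟨fun i j k => hB.1 i j _, fun i j k l => hB.2 i j _ _⟩ t (by omega)] at h1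
    · exact neg_eq_zero.1 h1.symm
    · intro i
      rw [Equiv.swap_apply_left, Equiv.swap_apply_of_ne_of_ne]
      · exact h i
      · simp [Fin.ext_iff]; omega
      · simp [Fin.ext_iff]; omega

theorem part_two {R : Type*} [Ring R] {m : ℕ} (B : Matrix (Fin m) (Fin m) R)
    (hB : IsRightQuantum B) (j₁ j₂ : Fin m) (hlt : j₁ < j₂)
    (h : ∀ i, B i j₁ = B i j₂) : cfDet B = 0 := by
  have hlt' : j₁.1 < j₂.1 := hlt
  have e : j₁.1 + (j₂.1 - j₁.1 - 1) + 1 = j₂.1 := by omega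
  refine part_two_lt (j₂.1 - j₁.1 - 1) B hB j₁.1 (by omega) fun i => ?_
  rw [h i]
  congr 1
  exact Fin.ext e.symm

/-- **Lemma (determinant properties of right-quantum matrices).**
(1) interchanging two adjacent columns of a right-quantum matrix negates the
Cartier-Foata determinant; (2) a right-quantum matrix with two equal columns
has Cartier-Foata determinant `0`; (3) Laplace expansion of the Cartier-Foata
determinant of an arbitrary matrix along the last column. -/
theorem right_quantum_det_properties (R : Type*) [Ring R] (m : ℕ) (hm : 1 ≤ m) :
    (∀ B : Matrix (Fin m) (Fin m) R, IsRightQuantum B →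
      ∀ t : ℕ, ∀ ht : t + 1 < m,
        cfDet (fun i j : Fin m =>
            B i (Equiv.swap (⟨t, by omega⟩ : Fin m) ⟨t + 1, ht⟩ j)) =
          - cfDet B) ∧
    (∀ B : Matrix (Fin m) (Fin m) R, IsRightQuantum B →
      ∀ j₁ j₂ : Fin m, j₁ ≠ j₂ → (∀ i : Fin m, B i j₁ = B i j₂) →
        cfDet B = 0) ∧
    (∀ B : Matrix (Fin m) (Fin m) R,
      cfDet B = ∑ i : Fin m,
        ((-1 : R) ^ (m + (i.1 + 1))) *
          cfDet (fun s t : Fin (m - 1) =>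
            B ⟨if s.1 < i.1 then s.1 else s.1 + 1, by split <;> omega⟩
              ⟨t.1, by omega⟩) *
          B i ⟨m - 1, by omega⟩) := by
  refine ⟨fun B hB t ht => part_one B hB t ht, ?_, ?_⟩
  · intro B hB j₁ j₂ hne h
    rcases lt_or_gt_of_ne hne with hlt | hlt
    · exact part_two B hB j₁ j₂ hlt h
    · exact part_two B hB j₂ j₁ hlt fun i => (h i).symm
  · intro B
    obtain ⟨n, rfl⟩ : ∃ n, m = n + 1 := ⟨m - 1, by omega⟩
    rw [laplace_aux]
    refine Finset.sum_congr rfl fun i _ => ?_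
    have : (fun s t : Fin n => B (i.succAbove s) t.castSucc) =
        (fun s t : Fin (n + 1 - 1) =>
            B ⟨if s.1 < i.1 then s.1 else s.1 + 1, by split <;> omega⟩
              ⟨t.1, by omega⟩) := by
      funext s t
      congr 1
      apply Fin.ext
      simp only [Fin.succAbove, Fin.lt_def, Fin.val_castSucc]
      split <;> rfl
    rw [this]
    rfl
end
end
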